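/- arXiv:1012.5963 — 11 statements merged into one kernel-verified Lean document; each statement's English description precedes it below -/
import Mathlib

section
/- Let f : ℝ → ℝ be a nonnegative continuous function and let 0 < c < C be real constants such that for all real t₁ ≤ t₂ one has f(t₂) + c·∫_{t₁}^{t₂} f(t) dt ≤ C·(t₂ − t₁) + f(t₁). Then f(t₂) ≤ f(t₁) + C/c for all t₂ ≥ t₁. -/
open MeasureTheory

/-- If `f : ℝ → ℝ` is a nonnegative continuous function and `0 < c < C` are constants such
that `f t₂ + c * ∫_{t₁}^{t₂} f ≤ C * (t₂ - t₁) + f t₁` for all `t₁ ≤ t₂`, then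
`f t₂ ≤ f t₁ + C / c` for all `t₂ ≥ t₁`. -/
theorem stmt0 (f : ℝ → ℝ) (hf_cont : Continuous f) (hf_nonneg : ∀ t, 0 ≤ f t)
    (c C : ℝ) (hc : 0 < c) (hcC : c < C)
    (h : ∀ t₁ t₂ : ℝ, t₁ ≤ t₂ →
      f t₂ + c * ∫ t in t₁..t₂, f t ≤ C * (t₂ - t₁) + f t₁) :
    ∀ t₁ t₂ : ℝ, t₁ ≤ t₂ → f t₂ ≤ f t₁ + C / c := by
  intro t₁ t₂ h12
  by_contra! hlt
  have hCc : 0 < C / c := div_pos (hc.trans hcC) hc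
  have hK : IsCompact (Set.Icc t₁ t₂ ∩ {s | f s ≤ f t₁ + C / c}) :=
    isCompact_Icc.inter_right (isClosed_le hf_cont continuous_const)
  obtain ⟨s, ⟨⟨hs1, hs2⟩, hs3⟩, hmax⟩ := hK.exists_isGreatest
    ⟨t₁, ⟨le_refl _, h12⟩, by simp only [Set.mem_setOf_eq]; linarith⟩
  simp only [Set.mem_setOf_eq] at hs3
  have hint : ∫ _t in s..t₂, C / c ≤ ∫ t in s..t₂, f t := by
    apply intervalIntegral.integral_mono_on_of_le_Ioo hs2
      (by simp) (hf_cont.intervalIntegrable _ _)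
    intro x hx
    by_contra! hxl
    have h1 := hmax ⟨⟨hs1.trans hx.1.le, hx.2.le⟩, by
      simp only [Set.mem_setOf_eq]; linarith [hf_nonneg t₁]⟩
    linarith [hx.1]
  rw [intervalIntegral.integral_const, smul_eq_mul] at hint
  have h2 := mul_le_mul_of_nonneg_left hint hc.le
  have h3 : c * ((t₂ - s) * (C / c)) = C * (t₂ - s) := by field_simp
  linarith [h s t₂ hs2]
end

section
/- Let n ≥ 3 be an integer, let 0 < a < b be real numbers, and let φ ∈ C¹([a,b]). Then a^{n-2}·φ(a)² ≤ b^{n-2}·φ(b)² + ∫_a^b (φ'(x))²·x^{n-1} dx. -/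
open MeasureTheory Set

/-- Lemma: for `n ≥ 3`, `0 < a < b` and `φ ∈ C¹([a,b])`,
`a^(n-2) φ(a)² ≤ b^(n-2) φ(b)² + ∫_a^b (φ'(x))² x^(n-1) dx`. -/
theorem stmt1 (n : ℕ) (hn : 3 ≤ n) (a b : ℝ) (ha : 0 < a) (hab : a < b)
    (φ φ' : ℝ → ℝ)
    (hderiv : ∀ x ∈ Icc a b, HasDerivWithinAt φ (φ' x) (Icc a b) x)
    (hcont : ContinuousOn φ' (Icc a b)) :
    a ^ (n - 2) * (φ a) ^ 2 ≤
      b ^ (n - 2) * (φ b) ^ 2 + ∫ x in a..b, (φ' x) ^ 2 * x ^ (n - 1) := by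
  obtain ⟨m, rfl⟩ : ∃ m, n = m + 3 := ⟨n - 3, by omega⟩
  have e1 : m + 3 - 2 = m + 1 := by omega
  have e2 : m + 3 - 1 = m + 2 := by omega
  rw [e1, e2]
  have hφ : ContinuousOn φ (Icc a b) := fun x hx => (hderiv x hx).continuousWithinAt
  have hu : uIcc a b = Icc a b := uIcc_of_le hab.le
  have hcg : ContinuousOn (fun x => ((m : ℝ) + 1) * x ^ m * (φ x) ^ 2
      + x ^ (m + 1) * (2 * φ x * φ' x)) (Icc a b) := by fun_prop
  have hch : ContinuousOn (fun x => (φ' x) ^ 2 * x ^ (m + 2)) (Icc a b) := by fun_prop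
  have hig := ContinuousOn.intervalIntegrable (μ := volume) (hu.symm ▸ hcg)
  have hih := ContinuousOn.intervalIntegrable (μ := volume) (hu.symm ▸ hch)
  have hF := intervalIntegral.integral_eq_sub_of_hasDerivAt_of_le hab.le
    (f := fun x => x ^ (m + 1) * (φ x) ^ 2)
    (f' := fun x => ((m : ℝ) + 1) * x ^ m * (φ x) ^ 2 + x ^ (m + 1) * (2 * φ x * φ' x))
    (by fun_prop)
    (fun x hx => by
      have h1 := (hderiv x (Ioo_subset_Icc_self hx)).hasDerivAt (Icc_mem_nhds hx.1 hx.2)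
      have h2 := (hasDerivAt_pow (m + 1) x).mul (h1.pow 2)
      refine h2.congr_deriv ?_
      simp) hig
  have hnn : 0 ≤ ∫ x in a..b, ((((m : ℝ) + 1) * x ^ m * (φ x) ^ 2
      + x ^ (m + 1) * (2 * φ x * φ' x)) + (φ' x) ^ 2 * x ^ (m + 2)) := by
    apply intervalIntegral.integral_nonneg hab.le
    intro x hx
    have hx0 : 0 < x := lt_of_lt_of_le ha hx.1
    have : (((m : ℝ) + 1) * x ^ m * (φ x) ^ 2
      + x ^ (m + 1) * (2 * φ x * φ' x)) + (φ' x) ^ 2 * x ^ (m + 2)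
      = x ^ m * (m * (φ x) ^ 2 + (φ x + x * φ' x) ^ 2) := by ring
    rw [this]
    positivity
  rw [intervalIntegral.integral_add hig hih, hF] at hnn
  linarith
end

section
/- Let n ≥ 3 be an integer, let 0 < a < b be real numbers, and let φ ∈ C¹([a,b]). Then (1/2)·∫_a^b (1/x²)·φ(x)²·x^{n-1} dx ≤ (1/(n-2))·b^{n-2}·φ(b)² + 2·(2/(n-2))²·∫_a^b (φ'(x))²·x^{n-1} dx. -/
open MeasureTheory Set

/-- Hardy inequality for finite intervals: for `n ≥ 3`, `0 < a < b` and `φ ∈ C¹([a,b])`,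
`(1/2) ∫_a^b φ(x)²/x² · x^(n-1) dx
  ≤ (1/(n-2)) b^(n-2) φ(b)² + 2 (2/(n-2))² ∫_a^b (φ'(x))² x^(n-1) dx`. -/
theorem stmt3 (n : ℕ) (hn : 3 ≤ n) (a b : ℝ) (ha : 0 < a) (hab : a < b)
    (φ φ' : ℝ → ℝ)
    (hderiv : ∀ x ∈ Icc a b, HasDerivWithinAt φ (φ' x) (Icc a b) x)
    (hcont : ContinuousOn φ' (Icc a b)) :
    (1 / 2) * ∫ x in a..b, (1 / x ^ 2) * (φ x) ^ 2 * x ^ (n - 1) ≤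
      (1 / ((n : ℝ) - 2)) * b ^ (n - 2) * (φ b) ^ 2 +
        2 * (2 / ((n : ℝ) - 2)) ^ 2 * ∫ x in a..b, (φ' x) ^ 2 * x ^ (n - 1) := by
  obtain ⟨m, rfl⟩ : ∃ m, n = m + 3 := ⟨n - 3, by omega⟩
  have e1 : m + 3 - 1 = m + 2 := by omega
  have e2 : m + 3 - 2 = m + 1 := by omega
  have e3 : ((m + 3 : ℕ) : ℝ) - 2 = (m : ℝ) + 1 := by push_cast; ring
  rw [e1, e2, e3]
  have hk : (0 : ℝ) < (m : ℝ) + 1 := by positivity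
  have hu : uIcc a b = Icc a b := uIcc_of_le hab.le
  have hφ : ContinuousOn φ (Icc a b) := fun x hx => (hderiv x hx).continuousWithinAt
  have hne : ∀ x ∈ Icc a b, x ^ 2 ≠ 0 := fun x hx => by
    have : 0 < x := lt_of_lt_of_le ha hx.1
    positivity
  have i1 : IntervalIntegrable (fun x => (1 / x ^ 2) * (φ x) ^ 2 * x ^ (m + 2)) volume a b := by
    apply ContinuousOn.intervalIntegrable
    rw [hu]
    exact ((continuousOn_const.div (by fun_prop) hne).mul (hφ.pow 2)).mul (by fun_prop)
  have i2 : IntervalIntegrable (fun x => (φ' x) ^ 2 * x ^ (m + 2)) volume a b := by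
    apply ContinuousOn.intervalIntegrable
    rw [hu]
    exact (hcont.pow 2).mul (by fun_prop)
  have i3 : IntervalIntegrable
      (fun x => x ^ m * φ x ^ 2 + 2 / ((m : ℝ) + 1) * (x ^ (m + 1) * (φ x * φ' x))) volume a b := by
    apply ContinuousOn.intervalIntegrable
    rw [hu]
    fun_prop
  have ftc := intervalIntegral.integral_eq_sub_of_hasDerivAt_of_le hab.le
    (f := fun x => 1 / ((m : ℝ) + 1) * x ^ (m + 1) * φ x ^ 2) (by fun_prop)
    (fun x hx => by
      have h1 := (hderiv x (Ioo_subset_Icc_self hx)).hasDerivAt (Icc_mem_nhds hx.1 hx.2)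
      have h2 := (((hasDerivAt_pow (m + 1) x).const_mul (1 / ((m : ℝ) + 1))).mul (h1.pow 2))
      refine h2.congr_deriv ?_
      simp
      field_simp) i3
  have key : ∫ x in a..b, ((1 / 2) * ((1 / x ^ 2) * (φ x) ^ 2 * x ^ (m + 2)) -
      2 * (2 / ((m : ℝ) + 1)) ^ 2 * ((φ' x) ^ 2 * x ^ (m + 2))) ≤
      ∫ x in a..b, (x ^ m * φ x ^ 2 + 2 / ((m : ℝ) + 1) * (x ^ (m + 1) * (φ x * φ' x))) := by
    apply intervalIntegral.integral_mono_on hab.le ((i1.const_mul _).sub (i2.const_mul _)) i3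
    intro x hx
    have hx0 : 0 < x := lt_of_lt_of_le ha hx.1
    have e : (1 / x ^ 2) * (φ x) ^ 2 * x ^ (m + 2) = x ^ m * φ x ^ 2 := by
      field_simp
      ring
    rw [e]
    generalize hc : 2 / ((m : ℝ) + 1) = c
    have hp : 0 ≤ x ^ m * (φ x + c * x * φ' x) ^ 2 := by positivity
    have hq : 0 ≤ x ^ m * (c * x * φ' x) ^ 2 := by positivity
    have r1 : x ^ (m + 1) = x ^ m * x := pow_succ _ _
    have r2 : x ^ (m + 2) = x ^ m * x ^ 2 := pow_add _ _ _
    rw [r1, r2]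
    nlinarith
  rw [ftc, intervalIntegral.integral_sub (i1.const_mul _) (i2.const_mul _),
    intervalIntegral.integral_const_mul, intervalIntegral.integral_const_mul] at key
  have hF : 0 ≤ 1 / ((m : ℝ) + 1) * a ^ (m + 1) * φ a ^ 2 := by positivity
  linarith
end

section
/- Let a > 0 and let φ ∈ C¹([a,∞)) be such that limsup_{x→∞} |φ(x)| < ∞. Then ∫_a^∞ φ(x)²/(1+x²) dx ≤ 8·((1+a²)/a²)·∫_a^∞ (φ'(x))² dx + 2π·∫_a^{a+1} ( φ(x)² + (φ'(x))² ) dx. -/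
open MeasureTheory Set Filter Real

lemma aux_F (a R : ℝ) (hR : a ≤ R) (φ φ' g g' u : ℝ → ℝ)
    (hderiv : ∀ x ∈ Ici a, HasDerivWithinAt φ (φ' x) (Ici a) x)
    (hcont : ContinuousOn φ' (Ici a))
    (hg : ∀ x, HasDerivAt g (g' x) x) (hg' : Continuous g') (hu : ContinuousOn u (Icc a R))
    (hle : ∀ x ∈ Icc a R, u x ≤ -(g' x * φ x ^ 2 + g x * (2 * φ x * φ' x))) :
    ∫ x in a..R, u x ≤ g a * φ a ^ 2 - g R * φ R ^ 2 := by
  have hgc : Continuous g := continuous_iff_continuousAt.2 fun x => (hg x).continuousAt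
  have hφ : ContinuousOn φ (Icc a R) := fun x hx =>
    ((hderiv x hx.1).continuousWithinAt).mono Icc_subset_Ici_self
  have hφ' : ContinuousOn φ' (Icc a R) := hcont.mono Icc_subset_Ici_self
  have hc : ContinuousOn (fun x => g' x * φ x ^ 2 + g x * (2 * φ x * φ' x)) (Icc a R) := by
    have h1 := hg'.continuousOn (s := Icc a R)
    have h2 := hgc.continuousOn (s := Icc a R)
    fun_prop
  have hI : IntervalIntegrable (fun x => g' x * φ x ^ 2 + g x * (2 * φ x * φ' x)) volume a R :=
    ContinuousOn.intervalIntegrable (by rwa [uIcc_of_le hR])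
  have key := intervalIntegral.integral_eq_sub_of_hasDerivAt_of_le (f := fun x => g x * φ x ^ 2)
    hR (hgc.continuousOn.mul (hφ.pow 2)) (fun x hx => by
      have h1 := (hderiv x hx.1.le).hasDerivAt (Ici_mem_nhds hx.1)
      have := (hg x).mul (h1.pow 2)
      refine this.congr_deriv ?_
      simp [Pi.pow_apply]) hI
  have hm := intervalIntegral.integral_mono_on hR
    (ContinuousOn.intervalIntegrable (by rwa [uIcc_of_le hR])) hI.neg hle
  have hn : ∫ x in a..R, (-fun x => g' x * φ x ^ 2 + g x * (2 * φ x * φ' x)) x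
      = -(g R * φ R ^ 2 - g a * φ a ^ 2) := by
    rw [← key, ← intervalIntegral.integral_neg]; rfl
  have : ∫ x in a..R, u x ≤ -(g R * φ R ^ 2 - g a * φ a ^ 2) := hn ▸ hm
  linarith

lemma aux_conv (a R : ℝ) (hR : a ≤ R) (f : ℝ → ℝ) (hf : ContinuousOn f (Icc a R))
    (h0 : ∀ x, 0 ≤ f x) :
    ∫⁻ x in Ioc a R, ENNReal.ofReal (f x) = ENNReal.ofReal (∫ x in a..R, f x) := by
  rw [intervalIntegral.integral_of_le hR, ofReal_integral_eq_lintegral_ofReal]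
  · exact (hf.integrableOn_Icc).mono_set Ioc_subset_Icc_self
  · exact Eventually.of_forall h0

lemma aux_h (x : ℝ) (hx : 0 < x) : π / 2 - arctan x ≤ 1 / x ∧ 0 < π / 2 - arctan x := by
  refine ⟨?_, by linarith [arctan_lt_pi_div_two x]⟩
  rw [← arctan_inv_of_pos hx, one_div]
  have hp : 0 < x⁻¹ := by positivity
  have := le_tan (x := arctan x⁻¹) (arctan_pos.2 hp).le (arctan_lt_pi_div_two _)
  rwa [tan_arctan] at this

lemma aux_pt (a x p q h : ℝ) (ha : 0 < a) (hx : a ≤ x) (h0 : 0 < h) (h1 : h ≤ 1 / x) :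
    p ^ 2 / (1 + x ^ 2) / 2 - 2 * ((1 + a ^ 2) / a ^ 2) * q ^ 2 ≤
      -(-(1 / (1 + x ^ 2)) * p ^ 2 + h * (2 * p * q)) := by
  have hx0 : 0 < x := by linarith
  have hK : h ^ 2 * (1 + x ^ 2) ≤ (1 + a ^ 2) / a ^ 2 := by
    have e1 : h ^ 2 ≤ (1 / x) ^ 2 := by gcongr
    have e2 : (1 / x) ^ 2 * (1 + x ^ 2) = 1 / x ^ 2 + 1 := by field_simp
    have e3 : (1 + a ^ 2) / a ^ 2 = 1 / a ^ 2 + 1 := by field_simp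
    have e4 : 1 / x ^ 2 ≤ 1 / a ^ 2 := by gcongr
    nlinarith [sq_nonneg x]
  have hq := mul_le_mul_of_nonneg_right hK (sq_nonneg q)
  have hsq : 0 ≤ (p - 2 * h * (1 + x ^ 2) * q) ^ 2 / (1 + x ^ 2) / 2 := by positivity
  have he : (p - 2 * h * (1 + x ^ 2) * q) ^ 2 / (1 + x ^ 2) / 2 =
    p ^ 2 / (1 + x ^ 2) / 2 - h * (2 * p * q) + 2 * (h ^ 2 * (1 + x ^ 2) * q ^ 2) := by
    field_simp; ring
  have : 1 / (1 + x ^ 2) * p ^ 2 = p ^ 2 / (1 + x ^ 2) := by ring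
  linarith

/-- Hardy inequality: for `a > 0` and `φ ∈ C¹([a,∞))` bounded near infinity,
`∫_a^∞ φ(x)²/(1+x²) dx ≤ 8 (1+a²)/a² ∫_a^∞ (φ'(x))² dx
  + 2π ∫_a^{a+1} (φ(x)² + (φ'(x))²) dx`, understood in `[0,∞]`. -/
theorem stmt4 (a : ℝ) (ha : 0 < a) (φ φ' : ℝ → ℝ)
    (hderiv : ∀ x ∈ Ici a, HasDerivWithinAt φ (φ' x) (Ici a) x)
    (hcont : ContinuousOn φ' (Ici a))
    (hbdd : ∃ M : ℝ, ∀ᶠ x in atTop, |φ x| ≤ M) :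
    (∫⁻ x in Ioi a, ENNReal.ofReal ((φ x) ^ 2 / (1 + x ^ 2))) ≤
      ENNReal.ofReal (8 * ((1 + a ^ 2) / a ^ 2)) *
          (∫⁻ x in Ioi a, ENNReal.ofReal ((φ' x) ^ 2)) +
        ENNReal.ofReal (2 * π) *
          ∫⁻ x in Ioo a (a + 1), ENNReal.ofReal ((φ x) ^ 2 + (φ' x) ^ 2) := by
  have hφ : ContinuousOn φ (Ici a) := fun x hx => (hderiv x hx).continuousWithinAt
  have hφR : ∀ R, ContinuousOn φ (Icc a R) := fun R => hφ.mono Icc_subset_Ici_self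
  have hφ'R : ∀ R, ContinuousOn φ' (Icc a R) := fun R => hcont.mono Icc_subset_Ici_self
  have hw : ∀ R, ContinuousOn (fun x => φ x ^ 2 / (1 + x ^ 2)) (Icc a R) := fun R =>
    ((hφR R).pow 2).div (by fun_prop) (fun x _ => by positivity)
  have hS : ∀ R, ContinuousOn (fun x => φ x ^ 2 + φ' x ^ 2) (Icc a R) := fun R =>
    ((hφR R).pow 2).add ((hφ'R R).pow 2)
  set K := (1 + a ^ 2) / a ^ 2 with hKdef
  have hK : 0 ≤ K := by positivity
  -- value at the left end
  have hA : φ a ^ 2 ≤ 2 * ∫ x in a..(a + 1), (φ x ^ 2 + φ' x ^ 2) := by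
    have := aux_F a (a + 1) (by linarith) φ φ' (fun x => x - a - 1) (fun _ => 1)
      (fun x => -2 * (φ x ^ 2 + φ' x ^ 2)) hderiv hcont
      (fun x => ((hasDerivAt_id x).sub_const a).sub_const 1) continuous_const
      (continuousOn_const.mul (hS _)) (fun x hx => by
        obtain ⟨h1, h2⟩ := hx
        set t := x - a - 1
        have ht : t ^ 2 ≤ 1 := by
          have : -1 ≤ t := by simp only [t]; linarith
          have : t ≤ 0 := by simp only [t]; linarith
          nlinarith
        nlinarith [sq_nonneg (φ x + t * φ' x), mul_le_mul_of_nonneg_right ht (sq_nonneg (φ' x)), sq_nonneg (φ' x), sq_nonneg (φ x)])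
    rw [intervalIntegral.integral_const_mul] at this
    simp at this
    linarith
  have hB : ∀ R, a ≤ R → ∫ x in a..R, φ x ^ 2 / (1 + x ^ 2) ≤
      8 * K * (∫ x in a..R, φ' x ^ 2) + 2 * π * ∫ x in a..(a + 1), (φ x ^ 2 + φ' x ^ 2) := by
    intro R hR
    have hwi : IntervalIntegrable (fun x => φ x ^ 2 / (1 + x ^ 2)) volume a R :=
      ContinuousOn.intervalIntegrable (by rw [uIcc_of_le hR]; exact hw R)
    have hdi : IntervalIntegrable (fun x => φ' x ^ 2) volume a R :=
      ContinuousOn.intervalIntegrable (by rw [uIcc_of_le hR]; exact (hφ'R R).pow 2)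
    have := aux_F a R hR φ φ' (fun x => π / 2 - arctan x) (fun x => -(1 / (1 + x ^ 2)))
      (fun x => φ x ^ 2 / (1 + x ^ 2) / 2 - 2 * K * φ' x ^ 2) hderiv hcont
      (fun x => (hasDerivAt_arctan x).const_sub _)
      ((continuous_const.div (by fun_prop) (fun x => by positivity)).neg)
      (((hw R).div_const 2).sub (continuousOn_const.mul ((hφ'R R).pow 2)))
      (fun x hx => by
        have hh := aux_h x (by linarith [hx.1])
        exact aux_pt a x (φ x) (φ' x) _ ha hx.1 hh.2 hh.1)
    rw [intervalIntegral.integral_sub (hwi.div_const 2) (hdi.const_mul _),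
      intervalIntegral.integral_const_mul, intervalIntegral.integral_div] at this
    have h1 : 0 ≤ (π / 2 - arctan R) * φ R ^ 2 :=
      mul_nonneg (aux_h R (by linarith)).2.le (sq_nonneg _)
    have h2 : (π / 2 - arctan a) * φ a ^ 2 ≤ π / 2 * φ a ^ 2 :=
      mul_le_mul_of_nonneg_right (by linarith [arctan_pos.2 ha]) (sq_nonneg _)
    have h3 := mul_le_mul_of_nonneg_left hA (by positivity : 0 ≤ π / 2)
    have h4 : 0 ≤ K * ∫ x in a..R, φ' x ^ 2 :=
      mul_nonneg hK (intervalIntegral.integral_nonneg hR fun x _ => sq_nonneg _)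
    linarith
  have hL : ∀ R, a ≤ R → ∫⁻ x in Ioc a R, ENNReal.ofReal (φ x ^ 2 / (1 + x ^ 2)) ≤
      ENNReal.ofReal (8 * K) * (∫⁻ x in Ioi a, ENNReal.ofReal ((φ' x) ^ 2)) +
        ENNReal.ofReal (2 * π) *
          ∫⁻ x in Ioo a (a + 1), ENNReal.ofReal ((φ x) ^ 2 + (φ' x) ^ 2) := by
    intro R hR
    calc _ = ENNReal.ofReal (∫ x in a..R, φ x ^ 2 / (1 + x ^ 2)) :=
          aux_conv a R hR _ (hw R) fun x => by positivity
      _ ≤ _ := ENNReal.ofReal_le_ofReal (hB R hR)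
      _ ≤ ENNReal.ofReal (8 * K) * ENNReal.ofReal (∫ x in a..R, φ' x ^ 2) +
          ENNReal.ofReal (2 * π) * ENNReal.ofReal (∫ x in a..(a + 1), (φ x ^ 2 + φ' x ^ 2)) := by
          rw [← ENNReal.ofReal_mul (by positivity), ← ENNReal.ofReal_mul (by positivity)]
          exact ENNReal.ofReal_add_le
      _ ≤ _ := by
          rw [← aux_conv a R hR (fun x => φ' x ^ 2) ((hφ'R R).pow 2) (fun x => sq_nonneg _),
            ← aux_conv a (a + 1) (by linarith) _ (hS _) (fun x => by positivity),
            setLIntegral_congr (Ioo_ae_eq_Ioc (a := a) (b := a + 1))]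
          gcongr
          exact Ioc_subset_Ioi_self
  have hU : Ioi a = ⋃ n : ℕ, Ioc a (a + n) := by
    ext x
    simp only [mem_Ioi, mem_iUnion, mem_Ioc]
    refine ⟨fun h => ?_, fun ⟨n, h, _⟩ => h⟩
    obtain ⟨n, hn⟩ := exists_nat_ge (x - a)
    exact ⟨n, h, by linarith⟩
  rw [hU, setLIntegral_iUnion_of_directed, ← hU]
  · exact iSup_le fun n => hL _ (by simp)
  · apply Monotone.directed_le
    intro m n hmn
    apply Ioc_subset_Ioc_right
    gcongr
end

section
/- Fix an integer n ≥ 3 and a real m > 0, and let r*(r) = ∫_{(nm)^{1/(n-2)}}^{r} (1 − 2m/s^{n-2})^{-1} ds for r > (2m)^{1/(n-2)}. Then for every r with r*(r) < 0 (equivalently (2m)^{1/(n-2)} < r < (nm)^{1/(n-2)}) one has 1 − 2m/r^{n-2} ≤ (2m)^{1/(n-2)} / (−r*(r)). -/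
open MeasureTheory

/-- For the Regge–Wheeler coordinate
`r*(r) = ∫_{(nm)^{1/(n-2)}}^{r} (1 - 2m/s^{n-2})⁻¹ ds` on the Schwarzschild exterior,
whenever `r*(r) < 0` (for `r > (2m)^{1/(n-2)}`) one has
`1 - 2m/r^{n-2} ≤ (2m)^{1/(n-2)} / (−r*(r))`. -/
theorem stmt7 (n : ℕ) (hn : 3 ≤ n) (m : ℝ) (hm : 0 < m)
    (rstar : ℝ → ℝ)
    (hrstar : ∀ r : ℝ,
      rstar r = ∫ s in ((n : ℝ) * m) ^ ((1 : ℝ) / ((n : ℝ) - 2))..r,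
        (1 - 2 * m / s ^ (n - 2))⁻¹) :
    ∀ r : ℝ, (2 * m) ^ ((1 : ℝ) / ((n : ℝ) - 2)) < r → rstar r < 0 →
      1 - 2 * m / r ^ (n - 2) ≤ (2 * m) ^ ((1 : ℝ) / ((n : ℝ) - 2)) / (-(rstar r)) := by
  intro r hr hneg
  obtain ⟨k, rfl⟩ : ∃ k, n = k + 2 := ⟨n - 2, by omega⟩
  have hk : k ≠ 0 := by omega
  have e1 : k + 2 - 2 = k := by omega
  have e2 : (1 : ℝ) / (((k + 2 : ℕ) : ℝ) - 2) = (k : ℝ)⁻¹ := by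
    push_cast
    rw [one_div]
    congr 1
    ring
  simp only [e1, e2] at hrstar hr ⊢
  have hn0 : (0 : ℝ) < ((k + 2 : ℕ) : ℝ) * m := by positivity
  have h2m : (0 : ℝ) < 2 * m := by positivity
  have ha0 : 0 < (2 * m) ^ ((k : ℝ)⁻¹) := Real.rpow_pos_of_pos h2m _
  have hb0 : 0 < (((k + 2 : ℕ) : ℝ) * m) ^ ((k : ℝ)⁻¹) := Real.rpow_pos_of_pos hn0 _
  have hak : ((2 * m) ^ ((k : ℝ)⁻¹)) ^ k = 2 * m := Real.rpow_inv_natCast_pow h2m.le hk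
  have hbk : ((((k + 2 : ℕ) : ℝ) * m) ^ ((k : ℝ)⁻¹)) ^ k = ((k + 2 : ℕ) : ℝ) * m :=
    Real.rpow_inv_natCast_pow hn0.le hk
  generalize (2 * m) ^ ((k : ℝ)⁻¹) = a at *
  generalize (((k + 2 : ℕ) : ℝ) * m) ^ ((k : ℝ)⁻¹) = b at *
  have hpow : k + 2 ≤ 2 ^ k * 2 := by
    have := Nat.lt_two_pow_self (n := k)
    omega
  have hb2 : b ≤ 2 * a := by
    refine le_of_pow_le_pow_left₀ hk (by positivity) ?_
    rw [mul_pow, hbk, hak, ← mul_assoc]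
    refine mul_le_mul_of_nonneg_right ?_ hm.le
    exact_mod_cast hpow
  have hab : a ≤ b := by
    refine le_of_pow_le_pow_left₀ hk hb0.le ?_
    rw [hbk, hak]
    refine mul_le_mul_of_nonneg_right ?_ hm.le
    push_cast
    linarith [(Nat.cast_nonneg k : (0 : ℝ) ≤ k)]
  have hpos : ∀ s, a < s → 0 < 1 - 2 * m / s ^ k := by
    intro s hs
    have hs0 : 0 < s := ha0.trans hs
    have : 2 * m < s ^ k := by
      rw [← hak]
      exact pow_lt_pow_left₀ hs ha0.le hk
    rw [sub_pos, div_lt_one (by positivity)]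
    exact this
  have hrb : r < b := by
    by_contra! h
    rw [hrstar] at hneg
    refine absurd hneg (not_lt.mpr (intervalIntegral.integral_nonneg h ?_))
    intro s hs
    have h1 : a ≤ s := hab.trans hs.1
    rcases h1.eq_or_lt with h1 | h1
    · rw [← h1, hak, div_self h2m.ne']
      simp
    · exact (inv_pos.mpr (hpos s h1)).le
  have hr0 : 0 < r := ha0.trans hr
  have hf := hpos r hr
  have hbound : -(rstar r) ≤ (1 - 2 * m / r ^ k)⁻¹ * |r - b| := by
    refine (neg_le_abs _).trans ?_
    rw [hrstar, ← Real.norm_eq_abs]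
    apply intervalIntegral.norm_integral_le_of_norm_le_const
    intro s hs
    rw [Set.uIoc_of_ge hrb.le] at hs
    have hs1 : r < s := hs.1
    rw [Real.norm_eq_abs, abs_of_pos (inv_pos.mpr (hpos s (hr.trans hs1)))]
    gcongr
  rw [abs_of_neg (by linarith)] at hbound
  rw [le_div_iff₀ (by linarith)]
  calc (1 - 2 * m / r ^ k) * -(rstar r)
      ≤ (1 - 2 * m / r ^ k) * ((1 - 2 * m / r ^ k)⁻¹ * -(r - b)) :=
        mul_le_mul_of_nonneg_left hbound hf.le
    _ = b - r := by
        rw [← mul_assoc, mul_inv_cancel₀ hf.ne']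
        ring
    _ ≤ a := by linarith
end

section
/- Fix an integer n ≥ 3 and a real m > 0, and let r*(r) = ∫_{(nm)^{1/(n-2)}}^{r} (1 − 2m/s^{n-2})^{-1} ds for r > (2m)^{1/(n-2)}. Then for every r with r*(r) ≤ 0 one has −r*(r) ≥ ((2m)^{1/(n-2)}/(n−2)) · log[ (((n/2)^{1/(n-2)} − 1)/((n/2)^{1/(n-2)} + 1)) · ((r/(2m)^{1/(n-2)} + 1)/(r/(2m)^{1/(n-2)} − 1)) ]. -/
open MeasureTheory Real



lemma aux_pow (a s : ℝ) (ha : 0 < a) (h : a < s) (k : ℕ) :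
    a * (s ^ k - a ^ k) ≤ k * s ^ k * (s - a) := by
  induction k with
  | zero => simp
  | succ k ih =>
    have h1 : a ^ (k + 1) ≤ s ^ (k + 1) := pow_le_pow_left₀ ha.le h.le _
    have h2 := mul_le_mul_of_nonneg_left ih (ha.trans h).le
    have h3 := mul_le_mul_of_nonneg_right h1 (sub_pos.2 h).le
    push_cast
    have e1 : a * (s ^ (k+1) - a ^ (k+1)) = s * (a * (s ^ k - a ^ k)) + a ^ (k+1) * (s - a) := by
      ring
    have e2 : ((k:ℝ) + 1) * s ^ (k+1) * (s - a)
        = s * (k * s ^ k * (s - a)) + s ^ (k+1) * (s - a) := by ring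
    rw [e1, e2]
    linarith

lemma aux_ineq (a s : ℝ) (ha : 0 < a) (h : a < s) (k : ℕ) (hk : 0 < k) :
    a / k * (1 / (s - a) - 1 / (s + a)) ≤ (1 - a ^ k / s ^ k)⁻¹ := by
  have hs : 0 < s := ha.trans h
  have hsk : 0 < s ^ k := by positivity
  have hlt : a ^ k < s ^ k := pow_lt_pow_left₀ h ha.le hk.ne'
  have hd : 0 < s - a := sub_pos.2 h
  have hd2 : 0 < s ^ k - a ^ k := sub_pos.2 hlt
  have hp : 0 < s + a := by linarith
  have hkr : (0:ℝ) < k := by exact_mod_cast hk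
  have e1 : (1 - a ^ k / s ^ k)⁻¹ = s ^ k / (s ^ k - a ^ k) := by
    rw [one_sub_div hsk.ne', inv_div]
  have e2 : a / k * (1 / (s - a) - 1 / (s + a)) = (2 * a * a) / (k * ((s - a) * (s + a))) := by
    field_simp
    ring
  rw [e1, e2, div_le_div_iff₀ (by positivity) hd2]
  have h1 := mul_le_mul_of_nonneg_left (aux_pow a s ha h k) (by positivity : 0 ≤ 2 * a)
  have h2 : 0 ≤ k * s ^ k * (s - a) * (s - a) := by positivity
  nlinarith

lemma aux_one (a s : ℝ) (ha : 0 < a) (h : a < s) (k : ℕ) (hk : 0 < k) :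
    0 < 1 - a ^ k / s ^ k ∧ 1 ≤ (1 - a ^ k / s ^ k)⁻¹ := by
  have hs : 0 < s := ha.trans h
  have hsk : 0 < s ^ k := by positivity
  have hlt : a ^ k < s ^ k := pow_lt_pow_left₀ h ha.le hk.ne'
  have h1 : a ^ k / s ^ k < 1 := (div_lt_one hsk).2 hlt
  have h2 : 0 ≤ a ^ k / s ^ k := by positivity
  exact ⟨by linarith, (one_le_inv₀ (by linarith)).2 (by linarith)⟩

lemma aux_int (a p q : ℝ) (ha : 0 < a) (hp : a < p) (hq : a < q) (k : ℕ) (hk : 0 < k) :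
    IntervalIntegrable (fun s : ℝ => (1 - a ^ k / s ^ k)⁻¹) volume p q := by
  apply ContinuousOn.intervalIntegrable
  have hh : ∀ s ∈ Set.uIcc p q, a < s := fun s hs => (lt_min hp hq).trans_le hs.1
  apply ContinuousOn.inv₀
  · apply ContinuousOn.sub continuousOn_const
    apply ContinuousOn.div continuousOn_const (by fun_prop)
    intro s hs
    exact pow_ne_zero _ (ha.trans (hh s hs)).ne'
  · intro s hs
    exact (aux_one a s ha (hh s hs) k hk).1.ne'

lemma aux_main (a p q : ℝ) (ha : 0 < a) (hp : a < p) (hpq : p ≤ q) (k : ℕ) (hk : 0 < k) :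
    a / k * (log (q - a) - log (q + a)) - a / k * (log (p - a) - log (p + a))
      ≤ ∫ s in p..q, (1 - a ^ k / s ^ k)⁻¹ := by
  have hh : ∀ s ∈ Set.uIcc p q, a < s := fun s hs => by
    rw [Set.uIcc_of_le hpq] at hs
    exact hp.trans_le hs.1
  have hi : IntervalIntegrable (fun s : ℝ => a / k * (1 / (s - a) - 1 / (s + a))) volume p q := by
    apply ContinuousOn.intervalIntegrable
    apply ContinuousOn.mul continuousOn_const
    apply ContinuousOn.sub
    · apply ContinuousOn.div continuousOn_const (by fun_prop)
      intro s hs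
      have := hh s hs
      exact (sub_pos.2 this).ne'
    · apply ContinuousOn.div continuousOn_const (by fun_prop)
      intro s hs
      have := hh s hs
      have : 0 < s + a := by linarith
      exact this.ne'
  rw [← intervalIntegral.integral_eq_sub_of_hasDerivAt
    (f := fun s => a / k * (log (s - a) - log (s + a))) (a := p) (b := q) ?_ hi]
  · apply intervalIntegral.integral_mono_on hpq hi (aux_int a p q ha hp (hp.trans_le hpq) k hk)
    intro s hs
    exact aux_ineq a s ha (hp.trans_le hs.1) k hk
  · intro s hs
    have h := hh s hs
    have h1 : s - a ≠ 0 := (sub_pos.2 h).ne'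
    have h2 : s + a ≠ 0 := by
      have : 0 < s + a := by linarith
      exact this.ne'
    exact ((((hasDerivAt_id s).sub_const a).log h1).sub
      (((hasDerivAt_id s).add_const a).log h2)).const_mul _

/-- For the Regge–Wheeler coordinate
`r*(r) = ∫_{(nm)^{1/(n-2)}}^{r} (1 - 2m/s^{n-2})⁻¹ ds` on the Schwarzschild exterior,
whenever `r*(r) ≤ 0` one has
`−r*(r) ≥ ((2m)^{1/(n-2)}/(n−2)) · log[ (((n/2)^{1/(n-2)} − 1)/((n/2)^{1/(n-2)} + 1))
  · ((r/(2m)^{1/(n-2)} + 1)/(r/(2m)^{1/(n-2)} − 1)) ]`. -/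
theorem stmt8 (n : ℕ) (hn : 3 ≤ n) (m : ℝ) (hm : 0 < m)
    (rstar : ℝ → ℝ)
    (hrstar : ∀ r : ℝ,
      rstar r = ∫ s in ((n : ℝ) * m) ^ ((1 : ℝ) / ((n : ℝ) - 2))..r,
        (1 - 2 * m / s ^ (n - 2))⁻¹) :
    ∀ r : ℝ, (2 * m) ^ ((1 : ℝ) / ((n : ℝ) - 2)) < r → rstar r ≤ 0 →
      -(rstar r) ≥
        ((2 * m) ^ ((1 : ℝ) / ((n : ℝ) - 2)) / ((n : ℝ) - 2)) *
          Real.log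
            ((((n : ℝ) / 2) ^ ((1 : ℝ) / ((n : ℝ) - 2)) - 1) /
                (((n : ℝ) / 2) ^ ((1 : ℝ) / ((n : ℝ) - 2)) + 1) *
              ((r / (2 * m) ^ ((1 : ℝ) / ((n : ℝ) - 2)) + 1) /
                (r / (2 * m) ^ ((1 : ℝ) / ((n : ℝ) - 2)) - 1))) := by
  intro r hr hneg
  obtain ⟨k, rfl⟩ : ∃ k, n = k + 2 := ⟨n - 2, by omega⟩
  have hk : 0 < k := by omega
  have hkr : (0:ℝ) < k := by exact_mod_cast hk
  have hc : (((k + 2 : ℕ) : ℝ) - 2) = k := by push_cast; ring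
  have hN : ((k + 2 : ℕ) : ℝ) * m = (2 * m) * (((k + 2 : ℕ) : ℝ) / 2) := by ring
  have hb1 : (1:ℝ) < ((k + 2 : ℕ) : ℝ) / 2 := by push_cast; linarith
  rw [hrstar] at hneg ⊢
  clear hrstar
  rw [hc] at hr hneg ⊢
  have hR : (((k + 2 : ℕ) : ℝ) * m) ^ ((1:ℝ) / k)
      = (2 * m) ^ ((1:ℝ) / k) * (((k + 2 : ℕ) : ℝ) / 2) ^ ((1:ℝ) / k) := by
    rw [hN, Real.mul_rpow (by positivity) (by positivity)]
  rw [hR] at hneg ⊢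
  clear hR hN
  have hak : ((2 * m) ^ ((1:ℝ) / k)) ^ k = 2 * m := by
    rw [one_div]
    exact Real.rpow_inv_natCast_pow (by positivity) hk.ne'
  have ha : 0 < (2 * m) ^ ((1:ℝ) / k) := by positivity
  have hb : 1 < (((k + 2 : ℕ) : ℝ) / 2) ^ ((1:ℝ) / k) := Real.one_lt_rpow hb1 (by positivity)
  simp only [Nat.add_sub_cancel] at hneg ⊢
  generalize (((k + 2 : ℕ) : ℝ) / 2) ^ ((1:ℝ) / k) = b at *
  generalize (2 * m) ^ ((1:ℝ) / k) = a at *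
  rw [← hak] at hneg ⊢
  have hab : a < a * b := by nlinarith
  have hle : r ≤ a * b := by
    by_contra! hlt
    have := intervalIntegral.integral_mono_on (f := fun _ : ℝ => (1:ℝ)) hlt.le
      (by simp) (aux_int a (a * b) r ha hab hr k hk)
      (fun s hs => (aux_one a s ha (hab.trans_le hs.1) k hk).2)
    simp only [intervalIntegral.integral_const, smul_eq_mul, mul_one] at this
    linarith
  rw [← intervalIntegral.integral_symm]
  refine le_trans (le_of_eq ?_) (aux_main a r (a * b) ha hr hle k hk)
  have h1 : 0 < r - a := sub_pos.2 hr
  have h2 : 0 < r + a := by linarith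
  have h3 : 0 < a * b - a := sub_pos.2 hab
  have h4 : 0 < a * b + a := by linarith
  have e : (b - 1) / (b + 1) * ((r / a + 1) / (r / a - 1))
      = ((a * b - a) / (a * b + a)) * ((r + a) / (r - a)) := by
    have e1 : (b - 1) / (b + 1) = (a * b - a) / (a * b + a) := by
      rw [← mul_div_mul_left _ _ ha.ne']; congr 1 <;> ring
    have e2 : (r / a + 1) / (r / a - 1) = (r + a) / (r - a) := by
      rw [← mul_div_mul_left _ _ ha.ne']; congr 1 <;> field_simp
    rw [e1, e2]
  rw [e, Real.log_mul (by positivity) (by positivity), Real.log_div h3.ne' h4.ne',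
    Real.log_div h2.ne' h1.ne']
  ring
end

section
/- Fix an integer n ≥ 3 and a real m > 0, set α = (n−1)/(nm)^{1/(n-2)} and γ = 12, and let r*(r) = ∫_{(nm)^{1/(n-2)}}^{r} (1 − 2m/s^{n-2})^{-1} ds for r > (2m)^{1/(n-2)}. If |r*(r)| ≤ 1/(γα), then (δ·n·m)^{1/(n-2)} < r < n/α, where δ = max{1/3, 8/(3n)}. -/
open MeasureTheory

lemma aux_int_s9 (k : ℕ) (m a b : ℝ) (hm : 0 < m) (hab : a ≤ b) (ha : 0 < a)
    (h : 2 * m < a ^ k) :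
    b - a ≤ ∫ s in a..b, (1 - 2 * m / s ^ k)⁻¹ := by
  have key : ∀ s ∈ Set.Icc a b, 0 < s ∧ 0 < 1 - 2 * m / s ^ k := by
    intro s hs
    have h0 : 0 < s := lt_of_lt_of_le ha hs.1
    have h1 : a ^ k ≤ s ^ k := pow_le_pow_left₀ ha.le hs.1 k
    refine ⟨h0, ?_⟩
    rw [sub_pos, div_lt_one (pow_pos h0 k)]
    linarith
  have hc : ContinuousOn (fun s : ℝ => (1 - 2 * m / s ^ k)⁻¹) (Set.uIcc a b) := by
    rw [Set.uIcc_of_le hab]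
    refine ContinuousOn.inv₀ (continuousOn_const.sub (continuousOn_const.div
      (continuousOn_id.pow k) ?_)) ?_
    · intro s hs
      exact (pow_pos (key s hs).1 k).ne'
    · intro s hs
      exact (key s hs).2.ne'
  have := intervalIntegral.integral_mono_on (μ := volume) hab
    (f := fun _ => (1 : ℝ)) (g := fun s : ℝ => (1 - 2 * m / s ^ k)⁻¹)
    (by simp) hc.intervalIntegrable ?_
  · simpa using this
  · intro s hs
    have h1 := (key s hs).2
    apply (one_le_inv₀ h1).2
    have : 0 ≤ 2 * m / s ^ k := div_nonneg (by linarith) (pow_pos (key s hs).1 k).le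
    linarith

/-- With `α = (n−1)/(nm)^{1/(n-2)}` and `γ = 12`, if `|r*(r)| ≤ 1/(γα)` then
`(δnm)^{1/(n-2)} < r < n/α` where `δ = max {1/3, 8/(3n)}`. -/
theorem stmt9 (n : ℕ) (hn : 3 ≤ n) (m : ℝ) (hm : 0 < m)
    (α γ δ : ℝ)
    (hα : α = ((n : ℝ) - 1) / ((n : ℝ) * m) ^ ((1 : ℝ) / ((n : ℝ) - 2)))
    (hγ : γ = 12)
    (hδ : δ = max (1 / 3) (8 / (3 * (n : ℝ))))
    (rstar : ℝ → ℝ)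
    (hrstar : ∀ r : ℝ,
      rstar r = ∫ s in ((n : ℝ) * m) ^ ((1 : ℝ) / ((n : ℝ) - 2))..r,
        (1 - 2 * m / s ^ (n - 2))⁻¹) :
    ∀ r : ℝ, (2 * m) ^ ((1 : ℝ) / ((n : ℝ) - 2)) < r →
      |rstar r| ≤ 1 / (γ * α) →
      (δ * (n : ℝ) * m) ^ ((1 : ℝ) / ((n : ℝ) - 2)) < r ∧ r < (n : ℝ) / α := by
  obtain ⟨k, rfl⟩ : ∃ k, n = k + 2 := ⟨n - 2, by omega⟩
  have hk : 1 ≤ k := by omega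
  have hkR : (1 : ℝ) ≤ k := by exact_mod_cast hk
  have hk0 : k ≠ 0 := by omega
  have e1 : (1 : ℝ) / (((k + 2 : ℕ) : ℝ) - 2) = (k : ℝ)⁻¹ := by push_cast; simp
  have e2 : k + 2 - 2 = k := by omega
  simp only [e1] at hα hrstar ⊢
  rw [e2] at hrstar
  clear e1 e2
  push_cast at *
  set R : ℝ := (((k : ℝ) + 2) * m) ^ ((k : ℝ)⁻¹) with hR
  have hnm : 0 < ((k : ℝ) + 2) * m := by positivity
  have hRpos : 0 < R := Real.rpow_pos_of_pos hnm _
  have hRk : R ^ k = ((k : ℝ) + 2) * m := Real.rpow_inv_natCast_pow hnm.le hk0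
  intro r hr hle
  have hr0 : 0 < r := lt_trans (Real.rpow_pos_of_pos (by positivity) _) hr
  have hrk : 2 * m < r ^ k := by
    have := pow_lt_pow_left₀ hr (Real.rpow_pos_of_pos (by positivity) _).le hk0
    rwa [Real.rpow_inv_natCast_pow (by positivity) hk0] at this
  have hRk2 : 2 * m < R ^ k := by rw [hRk]; nlinarith
  have hdist : |r - R| ≤ |rstar r| := by
    rw [hrstar]
    rcases le_total R r with h | h
    · have := aux_int_s9 k m R r hm h hRpos hRk2
      rw [abs_of_nonneg (by linarith)]
      exact this.trans (le_abs_self _)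
    · have := aux_int_s9 k m r R hm h hr0 hrk
      rw [intervalIntegral.integral_symm, abs_neg, abs_sub_comm, abs_of_nonneg (by linarith)]
      exact this.trans (le_abs_self _)
  have e3 : 1 / (γ * α) = R / (12 * ((k : ℝ) + 1)) := by
    have : (k : ℝ) + 2 - 1 = k + 1 := by ring
    rw [hγ, hα, this]
    field_simp
  rw [e3] at hle
  have hd := abs_le.1 (hdist.trans hle)
  have e4 : R / (12 * ((k : ℝ) + 1)) = R * (1 / (12 * ((k : ℝ) + 1))) := by ring
  set ε : ℝ := 1 / (12 * ((k : ℝ) + 1)) with hε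
  have hε0 : 0 < ε := by positivity
  have hεk : ε * (12 * ((k : ℝ) + 1)) = 1 := by rw [hε]; field_simp
  rw [e4] at hd
  constructor
  · have hδ1 : δ ≤ 8 / 9 := by
      rw [hδ]
      apply max_le (by norm_num)
      rw [div_le_div_iff₀ (by positivity) (by norm_num)]
      linarith
    have hb : 1 + (k : ℝ) * (-ε) ≤ (1 + -ε) ^ k :=
      one_add_mul_le_pow (by nlinarith) k
    have h1 : (R * (1 + -ε)) ^ k ≤ r ^ k :=
      pow_le_pow_left₀ (mul_nonneg hRpos.le (by nlinarith)) (by linarith [hd.1]) k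
    rw [mul_pow, hRk] at h1
    have h2 : δ < (1 + -ε) ^ k := by nlinarith
    have h3 : δ * ((k : ℝ) + 2) * m < r ^ k := by nlinarith
    have hδ0 : 0 < δ := by rw [hδ]; exact lt_max_of_lt_left (by norm_num)
    have hx : 0 ≤ δ * ((k : ℝ) + 2) * m := by positivity
    refine lt_of_pow_lt_pow_left₀ k hr0.le ?_
    rwa [Real.rpow_inv_natCast_pow hx hk0]
  · have : ((k : ℝ) + 2) / α = R + R * (12 * ε) := by
      have : (k : ℝ) + 2 - 1 = k + 1 := by ring
      rw [hα, this, hε]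
      field_simp
      ring
    rw [this]
    nlinarith [hd.2, mul_pos hRpos hε0]
end

section
/- Fix an integer n ≥ 3 and a real m > 0, set α = (n−1)/(nm)^{1/(n-2)} and γ = 12, and let r*(r) = ∫_{(nm)^{1/(n-2)}}^{r} (1 − 2m/s^{n-2})^{-1} ds for r > (2m)^{1/(n-2)}. If r*(r) ≥ (5/6)·(2/(γα)), then r/r*(r) ≤ 2γn. -/
open MeasureTheory

/-- With `α = (n−1)/(nm)^{1/(n-2)}` and `γ = 12`, if `r*(r) ≥ (5/6)·(2/(γα))` then
`r/r*(r) ≤ 2γn`. -/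
theorem stmt10 (n : ℕ) (hn : 3 ≤ n) (m : ℝ) (hm : 0 < m)
    (α γ : ℝ)
    (hα : α = ((n : ℝ) - 1) / ((n : ℝ) * m) ^ ((1 : ℝ) / ((n : ℝ) - 2)))
    (hγ : γ = 12)
    (rstar : ℝ → ℝ)
    (hrstar : ∀ r : ℝ,
      rstar r = ∫ s in ((n : ℝ) * m) ^ ((1 : ℝ) / ((n : ℝ) - 2))..r,
        (1 - 2 * m / s ^ (n - 2))⁻¹) :
    ∀ r : ℝ, (2 * m) ^ ((1 : ℝ) / ((n : ℝ) - 2)) < r →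
      (5 / 6) * (2 / (γ * α)) ≤ rstar r →
      r / rstar r ≤ 2 * γ * (n : ℝ) := by
  intro r hr hle
  obtain ⟨k, rfl⟩ : ∃ k, n = k + 2 := ⟨n - 2, by omega⟩
  have hk : k ≠ 0 := by omega
  have hk1 : (1 : ℝ) ≤ k := by exact_mod_cast Nat.one_le_iff_ne_zero.mpr hk
  have hcast : (1 : ℝ) / (((k + 2 : ℕ) : ℝ) - 2) = (k : ℝ)⁻¹ := by
    push_cast
    rw [add_sub_cancel_right, one_div]
  simp only [hcast, Nat.add_sub_cancel] at *
  have hnm : 0 < ((k + 2 : ℕ) : ℝ) * m := by positivity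
  set R : ℝ := (((k + 2 : ℕ) : ℝ) * m) ^ ((k : ℝ)⁻¹) with hR
  have hRpos : 0 < R := Real.rpow_pos_of_pos hnm _
  have hA0 : 0 < (2 * m) ^ ((k : ℝ)⁻¹) := Real.rpow_pos_of_pos (by positivity) _
  have hAk : ((2 * m) ^ ((k : ℝ)⁻¹)) ^ k = 2 * m :=
    Real.rpow_inv_natCast_pow (by positivity) hk
  have hAR : (2 * m) ^ ((k : ℝ)⁻¹) < R := by
    apply Real.rpow_lt_rpow (by positivity)
    · push_cast
      nlinarith
    · positivity
  have key : ∀ s : ℝ, (2 * m) ^ ((k : ℝ)⁻¹) < s → 0 < 1 - 2 * m / s ^ k ∧ 1 - 2 * m / s ^ k ≤ 1 := by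
    intro s hs
    have hs0 : 0 < s := hA0.trans hs
    have h1 : 2 * m < s ^ k := by
      rw [← hAk]
      exact pow_lt_pow_left₀ hs hA0.le hk
    have h2 : 2 * m / s ^ k < 1 := (div_lt_one (by positivity)).2 h1
    have h3 : 0 < 2 * m / s ^ k := by positivity
    constructor <;> linarith
  have hlow : (5 / 6) * (2 / (γ * α)) = 5 * R / (36 * ((k : ℝ) + 1)) := by
    rw [hα, hγ]
    push_cast
    have : (k : ℝ) + 2 - 1 = k + 1 := by ring
    rw [this]
    field_simp
    norm_num
  rw [hlow] at hle
  have hpos : 0 < rstar r := lt_of_lt_of_le (by positivity) hle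
  rcases lt_or_ge r R with h | h
  · exfalso
    have : rstar r ≤ 0 := by
      rw [hrstar, intervalIntegral.integral_symm]
      have := intervalIntegral.integral_nonneg (μ := volume) (f := fun s : ℝ => (1 - 2 * m / s ^ k)⁻¹) h.le
        (fun u hu => inv_nonneg.2 (key u (lt_of_lt_of_le hr hu.1)).1.le)
      linarith
    linarith
  · have hge : r - R ≤ rstar r := by
      rw [hrstar]
      have hc : ContinuousOn (fun s : ℝ => (1 - 2 * m / s ^ k)⁻¹) (Set.uIcc R r) := by
        rw [Set.uIcc_of_le h]
        have hne : ∀ s ∈ Set.Icc R r, s ^ k ≠ 0 := fun s hs =>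
          pow_ne_zero _ (lt_of_lt_of_le hRpos hs.1).ne'
        refine ContinuousOn.inv₀ ?_ (fun s hs => (key s (lt_of_lt_of_le hAR hs.1)).1.ne')
        exact continuousOn_const.sub (continuousOn_const.div (continuousOn_id.pow k) hne)
      have := intervalIntegral.integral_mono_on (μ := volume) (f := fun _ : ℝ => (1 : ℝ))
        (g := fun s : ℝ => (1 - 2 * m / s ^ k)⁻¹) h (by simp) hc.intervalIntegrable
        (fun s hs => by
          obtain ⟨h1, h2⟩ := key s (lt_of_lt_of_le hAR hs.1)
          exact (one_le_inv₀ h1).2 h2)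
      simpa using this
    rw [div_le_iff₀ hpos, hγ]
    rw [div_le_iff₀ (by positivity)] at hle
    push_cast
    nlinarith [mul_pos hpos (lt_of_lt_of_le one_pos hk1)]
end

section
/- Fix an integer n ≥ 3 and a real m > 0, set α = (n−1)/(nm)^{1/(n-2)} and γ = 12, and let r*(r) = ∫_{(nm)^{1/(n-2)}}^{r} (1 − 2m/s^{n-2})^{-1} ds for r > (2m)^{1/(n-2)}. Then for every natural number k with 1 ≤ k ≤ γ and every r with r*(r) = −k/(γα), one has (1 − 2m/r^{n-2})^{-1} ≤ 17; consequently, at the r with r*(r) = −1/(γα) one has −(1 − nm/r^{n-2}) ≥ (1/20)·(1/(2γ)). -/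
open MeasureTheory

theorem aux_main_s11 (p : ℕ) (hp : 1 ≤ p) (m R I r : ℝ) (hm : 0 < m) (hR : 0 < R)
    (hRp : R ^ p = ((p : ℝ) + 2) * m) (hr0 : 0 < r) (hr : 2 * m < r ^ p) (hI : 0 < I)
    (hint : ∫ s in R..r, (1 - 2 * m / s ^ p)⁻¹ = -I) :
    r < R ∧ (R - r) * (((p : ℝ) + 2) / p) ≤ I ∧ I ≤ (R - r) * (1 - 2 * m / r ^ p)⁻¹ := by
  have hpR : (1 : ℝ) ≤ p := by exact_mod_cast hp
  have hbound : ∀ s t : ℝ, 0 < s → 2 * m < s ^ p → s ≤ t →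
      0 < (1 - 2 * m / s ^ p) ∧ (1 - 2 * m / s ^ p) ≤ (1 - 2 * m / t ^ p) := by
    intro s t hs h2 hst
    have h1 : s ^ p ≤ t ^ p := pow_le_pow_left₀ hs.le hst p
    have h3 : 2 * m / s ^ p < 1 := by
      rw [div_lt_one (by positivity)]; exact h2
    have h4 : 2 * m / t ^ p ≤ 2 * m / s ^ p :=
      div_le_div_of_nonneg_left (by positivity) (by positivity) h1
    constructor <;> linarith
  have hlt : r < R := by
    by_contra hcon
    push Not at hcon
    have : 0 ≤ ∫ s in R..r, (1 - 2 * m / s ^ p)⁻¹ := by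
      apply intervalIntegral.integral_nonneg hcon
      intro u hu
      have h2 : 2 * m < R ^ p := by rw [hRp]; nlinarith
      have := hbound R u hR h2 hu.1
      exact inv_nonneg.mpr (by linarith)
    linarith
  have hanti : AntitoneOn (fun s : ℝ => (1 - 2 * m / s ^ p)⁻¹) (Set.uIcc r R) := by
    rw [Set.uIcc_of_le hlt.le]
    intro a ha b hb hab
    have h1 : r ^ p ≤ a ^ p := pow_le_pow_left₀ hr0.le ha.1 p
    have := hbound a b (hr0.trans_le ha.1) (by linarith) hab
    exact inv_anti₀ this.1 this.2
  have hii : IntervalIntegrable (fun s : ℝ => (1 - 2 * m / s ^ p)⁻¹) volume r R :=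
    hanti.intervalIntegrable
  have hI' : ∫ s in r..R, (1 - 2 * m / s ^ p)⁻¹ = I := by
    rw [intervalIntegral.integral_symm, hint, neg_neg]
  rw [Set.uIcc_of_le hlt.le] at hanti
  have hfR : (1 - 2 * m / R ^ p)⁻¹ = ((p : ℝ) + 2) / p := by
    rw [hRp]
    have : (1 - 2 * m / (((p : ℝ) + 2) * m)) = p / ((p : ℝ) + 2) := by
      field_simp
      ring
    rw [this, inv_div]
  refine ⟨hlt, ?_, ?_⟩
  · have := intervalIntegral.integral_mono_on hlt.le
      (intervalIntegrable_const (c := ((p : ℝ) + 2) / p)) hii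
      (fun x hx => by
        rw [← hfR]
        exact hanti hx (Set.right_mem_Icc.mpr hlt.le) hx.2)
    rw [intervalIntegral.integral_const, hI'] at this
    simpa using this
  · have := intervalIntegral.integral_mono_on hlt.le hii
      (intervalIntegrable_const (c := (1 - 2 * m / r ^ p)⁻¹))
      (fun x hx => hanti (Set.left_mem_Icc.mpr hlt.le) hx hx.1)
    rw [intervalIntegral.integral_const, hI'] at this
    simpa using this

theorem aux_one_s11 (p : ℕ) (hp : 1 ≤ p) (m R I r : ℝ) (hm : 0 < m) (hR : 0 < R)
    (hRp : R ^ p = ((p : ℝ) + 2) * m) (hr0 : 0 < r)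
    (hI : I ≤ R / (p + 1))
    (h : (R - r) * (((p : ℝ) + 2) / p) ≤ I) : (1 - 2 * m / r ^ p)⁻¹ ≤ 17 := by
  have hpR : (1 : ℝ) ≤ p := by exact_mod_cast hp
  obtain ⟨x, rfl⟩ : ∃ x, r = R * x := ⟨r / R, by field_simp⟩
  have hx : 0 < x := (mul_pos_iff_of_pos_left hR).mp hr0
  have hb : 1 + (p : ℝ) * (x - 1) ≤ x ^ p := by
    have := one_add_mul_le_pow (a := x - 1) (by linarith) p
    simpa using this
  have h1 : R * ((1 - x) * (((p : ℝ) + 2) / p)) ≤ R * (1 / (p + 1)) := by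
    calc _ = (R - R * x) * (((p : ℝ) + 2) / p) := by ring
      _ ≤ R / (p + 1) := h.trans hI
      _ = _ := by ring
  have h2 := le_of_mul_le_mul_left h1 hR
  have h3 : (1 - x) * ((p : ℝ) + 2) * (p + 1) ≤ p := by
    rw [← mul_div_assoc, div_le_div_iff₀ (by positivity) (by positivity)] at h2
    linarith
  have h4 : 17 ≤ 8 * ((p : ℝ) + 2) * x ^ p := by
    have h5 : 17 * ((p : ℝ) + 1) ≤ (8 * ((p : ℝ) + 2) * x ^ p) * (p + 1) := by
      have := mul_le_mul_of_nonneg_left hb (by positivity : 0 ≤ 8 * ((p : ℝ) + 2) * (p + 1))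
      have h6 := mul_le_mul_of_nonneg_left h3 (by positivity : 0 ≤ 8 * (p : ℝ))
      nlinarith
    exact le_of_mul_le_mul_right h5 (by positivity)
  have h7 : 2 * m / (R * x) ^ p ≤ 16 / 17 := by
    rw [mul_pow, hRp, div_le_div_iff₀ (by positivity) (by positivity)]
    nlinarith
  calc (1 - 2 * m / (R * x) ^ p)⁻¹ ≤ (1 / 17 : ℝ)⁻¹ :=
        inv_anti₀ (by norm_num) (by linarith)
    _ = 17 := by norm_num

theorem aux_two (p : ℕ) (hp : 1 ≤ p) (m R r : ℝ) (hm : 0 < m) (hR : 0 < R)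
    (hRp : R ^ p = ((p : ℝ) + 2) * m) (hr0 : 0 < r) (hlt : r < R)
    (h : R / (12 * (p + 1)) ≤ (R - r) * 17) :
    1 + 1 / 480 ≤ ((p : ℝ) + 2) * m / r ^ p := by
  have hpR : (1 : ℝ) ≤ p := by exact_mod_cast hp
  rw [← hRp, ← div_pow]
  have hy : 1 + (R - r) / R ≤ R / r := by
    have : R / r - (1 + (R - r) / R) = (R - r) ^ 2 / (R * r) := by
      field_simp
      ring
    have h2 : 0 ≤ (R - r) ^ 2 / (R * r) := by positivity
    linarith
  have h1 : 1 / (204 * ((p : ℝ) + 1)) ≤ (R - r) / R := by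
    rw [div_le_div_iff₀ (by positivity) hR]
    rw [div_le_iff₀ (by positivity)] at h
    linarith
  have hb : 1 + (p : ℝ) * (R / r - 1) ≤ (R / r) ^ p := by
    have hpos : 0 < R / r := by positivity
    have := one_add_mul_le_pow (a := R / r - 1) (by linarith) p
    simpa using this
  have h2 : 1 / 408 ≤ (p : ℝ) * (1 / (204 * ((p : ℝ) + 1))) := by
    rw [mul_one_div, div_le_div_iff₀ (by positivity) (by positivity)]
    linarith
  have h3 : (p : ℝ) * (1 / (204 * ((p : ℝ) + 1))) ≤ p * (R / r - 1) :=
    mul_le_mul_of_nonneg_left (by linarith) (by positivity)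
  linarith

/-- With `α = (n−1)/(nm)^{1/(n-2)}` and `γ = 12`: for every natural `1 ≤ k ≤ γ` and every
`r` with `r*(r) = −k/(γα)` one has `(1 − 2m/r^{n-2})⁻¹ ≤ 17`; consequently at the `r` with
`r*(r) = −1/(γα)` one has `−(1 − nm/r^{n-2}) ≥ (1/20)·(1/(2γ))`. -/
theorem stmt11 (n : ℕ) (hn : 3 ≤ n) (m : ℝ) (hm : 0 < m)
    (α γ : ℝ)
    (hα : α = ((n : ℝ) - 1) / ((n : ℝ) * m) ^ ((1 : ℝ) / ((n : ℝ) - 2)))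
    (hγ : γ = 12)
    (rstar : ℝ → ℝ)
    (hrstar : ∀ r : ℝ,
      rstar r = ∫ s in ((n : ℝ) * m) ^ ((1 : ℝ) / ((n : ℝ) - 2))..r,
        (1 - 2 * m / s ^ (n - 2))⁻¹) :
    (∀ k : ℕ, 1 ≤ k → (k : ℝ) ≤ γ →
      ∀ r : ℝ, (2 * m) ^ ((1 : ℝ) / ((n : ℝ) - 2)) < r →
        rstar r = -((k : ℝ) / (γ * α)) →
        (1 - 2 * m / r ^ (n - 2))⁻¹ ≤ 17) ∧
    (∀ r : ℝ, (2 * m) ^ ((1 : ℝ) / ((n : ℝ) - 2)) < r →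
      rstar r = -(1 / (γ * α)) →
      -(1 - (n : ℝ) * m / r ^ (n - 2)) ≥ (1 / 20) * (1 / (2 * γ))) := by
  obtain ⟨p, rfl⟩ : ∃ p, n = p + 2 := ⟨n - 2, by omega⟩
  have hp : 1 ≤ p := by omega
  have hpR : (1 : ℝ) ≤ p := by exact_mod_cast hp
  have e1 : (((p + 2 : ℕ) : ℝ) - 2) = p := by push_cast; ring
  have e2 : p + 2 - 2 = p := by omega
  have e3 : ((p + 2 : ℕ) : ℝ) = (p : ℝ) + 2 := by push_cast; ring
  rw [e1, e3] at hα
  simp only [e2, e3, add_sub_cancel_right] at hrstar ⊢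
  have hpow : ∀ a : ℝ, 0 < a → (a ^ ((1 : ℝ) / p)) ^ p = a := by
    intro a ha
    rw [one_div, Real.rpow_inv_natCast_pow ha.le (by omega)]
  have hR : 0 < (((p : ℝ) + 2) * m) ^ ((1 : ℝ) / p) := by positivity
  have hRp := hpow (((p : ℝ) + 2) * m) (by positivity)
  generalize (((p : ℝ) + 2) * m) ^ ((1 : ℝ) / p) = R at *
  have hr0 : ∀ r : ℝ, (2 * m) ^ ((1 : ℝ) / p) < r → 0 < r ∧ 2 * m < r ^ p := by
    intro r hr
    have h0 : 0 < (2 * m) ^ ((1 : ℝ) / p) := by positivity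
    refine ⟨h0.trans hr, ?_⟩
    have := pow_lt_pow_left₀ hr h0.le (by omega : p ≠ 0)
    rwa [hpow _ (by positivity)] at this
  have hγα : ∀ c : ℝ, c / (γ * α) = c / 12 * (R / (p + 1)) := by
    intro c
    rw [hα, hγ]
    have : (p : ℝ) + 2 - 1 = p + 1 := by ring
    rw [this]
    field_simp
  have hRp1 : 0 < R / ((p : ℝ) + 1) := by positivity
  have key : ∀ k : ℕ, 1 ≤ k → (k : ℝ) ≤ γ →
      ∀ r : ℝ, (2 * m) ^ ((1 : ℝ) / p) < r →
        rstar r = -((k : ℝ) / (γ * α)) →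
        (1 - 2 * m / r ^ p)⁻¹ ≤ 17 ∧ r < R ∧
          (k : ℝ) / 12 * (R / (p + 1)) ≤ (R - r) * (1 - 2 * m / r ^ p)⁻¹ := by
    intro k hk hk2 r hr he
    have hkR : (1 : ℝ) ≤ k := by exact_mod_cast hk
    rw [hrstar, hγα] at he
    obtain ⟨h0, h1⟩ := hr0 r hr
    obtain ⟨a, b, c⟩ := aux_main_s11 p hp m R _ r hm hR hRp h0 h1 (by positivity) he
    refine ⟨aux_one_s11 p hp m R _ r hm hR hRp h0 ?_ b, a, c⟩
    have : (k : ℝ) / 12 ≤ 1 := by linarith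
    exact mul_le_of_le_one_left hRp1.le this
  refine ⟨fun k hk hk2 r hr he => (key k hk hk2 r hr he).1, ?_⟩
  intro r hr he
  obtain ⟨a, b, c⟩ := key 1 le_rfl (by rw [hγ]; norm_num) r hr (by simpa using he)
  have := aux_two p hp m R r hm hR hRp (hr0 r hr).1 b (by
    calc R / (12 * ((p : ℝ) + 1)) = ((1 : ℕ) : ℝ) / 12 * (R / (p + 1)) := by
          push_cast; field_simp
      _ ≤ _ := c
      _ ≤ _ := mul_le_mul_of_nonneg_left a (by linarith))
  rw [hγ]
  norm_num at this ⊢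
  linarith
end

section
/- There exists a real α₀ > 0 such that for every integer n ≥ 4, every real α ≥ α₀, and every real x with −α ≤ x ≤ α, one has (α − x)·(x + α + √α)³ ≤ (n−1)·(x² + α²)². -/
/-- There is `α₀ > 0` such that for all integers `n ≥ 4`, all `α ≥ α₀` and all
`x ∈ [−α, α]`, `(α − x)(x + α + √α)³ ≤ (n−1)(x² + α²)²`. -/
theorem stmt15 :
    ∃ α₀ : ℝ, 0 < α₀ ∧
      ∀ (n : ℕ), 4 ≤ n → ∀ (α x : ℝ), α₀ ≤ α → -α ≤ x → x ≤ α →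
        (α - x) * (x + α + Real.sqrt α) ^ 3 ≤ ((n : ℝ) - 1) * (x ^ 2 + α ^ 2) ^ 2 := by
  refine ⟨100, by norm_num, ?_⟩
  intro n hn α x hα h1 h2
  have hn' : (4 : ℝ) ≤ n := by exact_mod_cast hn
  have hs0 := Real.sqrt_nonneg α
  have hs : Real.sqrt α ≤ α / 10 := by
    rw [Real.sqrt_le_left (by linarith)]
    nlinarith
  set s := Real.sqrt α
  have key : ∀ a y : ℝ, 0 ≤ a → 0 ≤ y → 256 * (a * y ^ 3) ≤ 27 * (a + y) ^ 4 := by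
    intro a y ha hy
    have h : 0 ≤ (3 * a - y) ^ 2 * (3 * a ^ 2 + 14 * (a * y) + 27 * y ^ 2) := by positivity
    nlinarith [h]
  have k := key (α - x) (x + α + s) (by linarith) (by linarith)
  have e : (α - x + (x + α + s)) ^ 4 ≤ (21 / 10 * α) ^ 4 :=
    pow_le_pow_left₀ (by linarith) (by linarith) 4
  have f : α ^ 4 ≤ (x ^ 2 + α ^ 2) ^ 2 := by
    nlinarith [mul_nonneg (sq_nonneg x) (sq_nonneg α), sq_nonneg (x ^ 2)]
  have g : 3 * (x ^ 2 + α ^ 2) ^ 2 ≤ ((n : ℝ) - 1) * (x ^ 2 + α ^ 2) ^ 2 :=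
    mul_le_mul_of_nonneg_right (by linarith) (by positivity)
  have p : 0 ≤ α ^ 4 := by positivity
  rw [mul_pow] at e
  norm_num at e
  linarith
end

section
/- Let n ≥ 3 be an integer, m > 0 a real number, and r > (2m)^{1/(n-2)}. Then ∫_{(2m)^{1/(n-2)}}^{r} (1 − 2m/s^{n-2})⁵ ds ≥ (1/4)·(1/(5(n−2)))·(1 − 2m/r^{n-2})⁶·(2m)^{1/(n-2)}. -/
open MeasureTheory

theorem aux17 (j : ℕ) (a r : ℝ) (ha : 0 < a) (hr : a < r) :
    (a / (6 * ((j : ℝ) + 1))) * (1 - a ^ (j + 1) / r ^ (j + 1)) ^ 6 ≤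
      ∫ s in a..r, (1 - a ^ (j + 1) / s ^ (j + 1)) ^ 5 := by
  have hpos : ∀ s ∈ Set.uIcc a r, 0 < s := by
    intro s hs
    rw [Set.uIcc_of_le hr.le] at hs
    exact ha.trans_le hs.1
  have hj : (0 : ℝ) < (j : ℝ) + 1 := by positivity
  have hd : ∀ s ∈ Set.uIcc a r, HasDerivAt
      (fun s : ℝ => (a / (6 * ((j : ℝ) + 1))) * (1 - a ^ (j + 1) / s ^ (j + 1)) ^ 6)
      ((1 - a ^ (j + 1) / s ^ (j + 1)) ^ 5 * (a / s) ^ (j + 2)) s := by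
    intro s hs
    have h0 := hpos s hs
    have h1 := (((((hasDerivAt_pow (j + 1) s).fun_inv (by positivity)).const_mul
      (a ^ (j + 1))).const_sub 1).fun_pow 6).const_mul (a / (6 * ((j : ℝ) + 1)))
    simp only [← div_eq_mul_inv] at h1
    refine h1.congr_deriv ?_
    generalize (1 - a ^ (j + 1) / s ^ (j + 1)) = x
    simp only [Nat.add_sub_cancel, div_pow]
    push_cast
    norm_num
    field_simp
    ring
  have c1 : ContinuousOn (fun s : ℝ => (1 - a ^ (j + 1) / s ^ (j + 1)) ^ 5) (Set.uIcc a r) := by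
    refine ContinuousOn.pow (continuousOn_const.sub (continuousOn_const.div (by fun_prop) ?_)) 5
    intro s hs
    have := hpos s hs
    positivity
  have c2 : ContinuousOn (fun s : ℝ => (1 - a ^ (j + 1) / s ^ (j + 1)) ^ 5 * (a / s) ^ (j + 2))
      (Set.uIcc a r) := by
    refine c1.mul (ContinuousOn.pow (continuousOn_const.div continuousOn_id ?_) _)
    intro s hs
    exact (hpos s hs).ne'
  have hI := intervalIntegral.integral_eq_sub_of_hasDerivAt hd c2.intervalIntegrable
  have ha1 : (1 - a ^ (j + 1) / a ^ (j + 1)) = 0 := by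
    rw [div_self (by positivity), sub_self]
  rw [ha1] at hI
  have hmono : ∀ s ∈ Set.Icc a r, (1 - a ^ (j + 1) / s ^ (j + 1)) ^ 5 * (a / s) ^ (j + 2) ≤
      (1 - a ^ (j + 1) / s ^ (j + 1)) ^ 5 := by
    intro s hs
    have h0 : 0 < s := ha.trans_le hs.1
    have h1 : a / s ≤ 1 := (div_le_one h0).2 hs.1
    have h2 : (a / s) ^ (j + 2) ≤ 1 := pow_le_one₀ (by positivity) h1
    have h3 : a ^ (j + 1) / s ^ (j + 1) ≤ 1 := by
      rw [← div_pow]; exact pow_le_one₀ (by positivity) h1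
    exact mul_le_of_le_one_right (pow_nonneg (by linarith) 5) h2
  have hI2 := intervalIntegral.integral_mono_on (μ := volume) hr.le c2.intervalIntegrable
    c1.intervalIntegrable hmono
  rw [hI] at hI2
  simpa using hI2

/-- For `n ≥ 3`, `m > 0` and `r > (2m)^{1/(n-2)}`:
`∫_{(2m)^{1/(n-2)}}^{r} (1 − 2m/s^{n-2})⁵ ds
  ≥ (1/4)·(1/(5(n−2)))·(1 − 2m/r^{n-2})⁶·(2m)^{1/(n-2)}`. -/
theorem stmt17 (n : ℕ) (hn : 3 ≤ n) (m : ℝ) (hm : 0 < m) (r : ℝ)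
    (hr : (2 * m) ^ ((1 : ℝ) / ((n : ℝ) - 2)) < r) :
    (∫ s in (2 * m) ^ ((1 : ℝ) / ((n : ℝ) - 2))..r, (1 - 2 * m / s ^ (n - 2)) ^ 5) ≥
      (1 / 4) * (1 / (5 * ((n : ℝ) - 2))) * (1 - 2 * m / r ^ (n - 2)) ^ 6 *
        (2 * m) ^ ((1 : ℝ) / ((n : ℝ) - 2)) := by
  obtain ⟨j, rfl⟩ := Nat.exists_eq_add_of_le' hn
  have e : ((j + 3 : ℕ) : ℝ) - 2 = (j : ℝ) + 1 := by push_cast; ring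
  have e2 : j + 3 - 2 = j + 1 := by omega
  rw [e] at hr ⊢
  rw [e2]
  have hj : (0 : ℝ) < (j : ℝ) + 1 := by positivity
  have ha : 0 < (2 * m) ^ ((1 : ℝ) / ((j : ℝ) + 1)) := by positivity
  have hak : ((2 * m) ^ ((1 : ℝ) / ((j : ℝ) + 1))) ^ (j + 1) = 2 * m := by
    rw [← Real.rpow_natCast, ← Real.rpow_mul (by positivity)]
    push_cast
    rw [one_div_mul_cancel hj.ne', Real.rpow_one]
  have h := aux17 j _ r ha hr
  rw [hak] at h
  refine le_trans ?_ h
  generalize (2 * m) ^ ((1 : ℝ) / ((j : ℝ) + 1)) = a at ha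
  have hx : 0 ≤ (1 - 2 * m / r ^ (j + 1)) ^ 6 := by positivity
  generalize (1 - 2 * m / r ^ (j + 1)) ^ 6 = y at hx
  have : a / (6 * ((j : ℝ) + 1)) * y - 1 / 4 * (1 / (5 * ((j : ℝ) + 1))) * y * a
    = (7 / 60) * (a * y / ((j : ℝ) + 1)) := by
    field_simp; ring
  have h2 : 0 ≤ a * y / ((j : ℝ) + 1) := by positivity
  linarith
end
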